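/- arXiv:1010.3674 — 2 statements merged into one kernel-verified Lean document; each statement's English description precedes it below -/
import Mathlib

section
/- In any CPmem-algebra, the equation (MSCL4) holds: for all x, y, z, u, ((x ∧· y) ∨· (¬x ∧· z)) ∧· u = (x ∨· (z ∧· u)) ∧· (¬x ∨· (y ∧· u)). -/
/-- A CPmem-algebra: a type with constants `T`, `F` and Hoare's ternary conditional
`cond x y z` (written `x ◁ y ▷ z`) satisfying (CP1)–(CP4) and (CPmem). -/
structure CPmemAlg (M : Type*) where
  T : M
  F : M
  cond : M → M → M → M
  cp1 : ∀ x y, cond x T y = x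
  cp2 : ∀ x y, cond x F y = y
  cp3 : ∀ x, cond T x F = x
  cp4 : ∀ x y z u v, cond x (cond y z u) v = cond (cond x y v) z (cond x u v)
  cpmem : ∀ x y z u v w,
    cond x y (cond z u (cond v y w)) = cond x y (cond z u w)

namespace CPmemAlg
variable {M : Type*}
/-- Negation: `¬x = F ◁ x ▷ T`. -/
def neg (A : CPmemAlg M) (x : M) : M := A.cond A.F x A.T
/-- Left-sequential conjunction: `x ∧· y = y ◁ x ▷ F`. -/
def sand (A : CPmemAlg M) (x y : M) : M := A.cond y x A.F
/-- Left-sequential disjunction: `x ∨· y = ¬(¬x ∧· ¬y)`. -/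
def sor (A : CPmemAlg M) (x y : M) : M := A.neg (A.sand (A.neg x) (A.neg y))
end CPmemAlg

namespace CPmemAlg

theorem cond_neg {M : Type*} (A : CPmemAlg M) (x y z : M) :
    A.cond x (A.neg y) z = A.cond z y x := by
  rw [neg, A.cp4, A.cp1, A.cp2]

theorem sor_eq_cond {M : Type*} (A : CPmemAlg M) (x y : M) :
    A.sor x y = A.cond A.T x y := by
  have neg_neg : A.cond A.F (A.neg y) A.T = y := by rw [cond_neg, A.cp3]
  rw [sor, sand, cond_neg, neg, A.cp4, A.cp2, neg_neg]

theorem cond_cond_right {M : Type*} (A : CPmemAlg M) (x y v w : M) :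
    A.cond x y (A.cond v y w) = A.cond x y w := by
  simpa only [A.cp2] using A.cpmem x y A.T A.F v w

/-- The mirror image of (CPmem), with the repeated test on the left and in the right branch. -/
theorem cond_cond_cond_left {M : Type*} (A : CPmemAlg M) (x y z u v w : M) :
    A.cond (A.cond z u (A.cond w y v)) y x = A.cond (A.cond z u w) y x := by
  simpa only [cond_neg] using A.cpmem x (A.neg y) z u v w

theorem cond_cond_left {M : Type*} (A : CPmemAlg M) (x y v w : M) :
    A.cond (A.cond w y v) y x = A.cond w y x := by
  simpa only [A.cp2] using A.cond_cond_cond_left x y A.T A.F v w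

/-- (CPmem) with the repeated test in the left branch of the inner conditional. -/
theorem cond_cond_cond_right {M : Type*} (A : CPmemAlg M) (x y z u v w : M) :
    A.cond x y (A.cond (A.cond v y w) u z) = A.cond x y (A.cond w u z) := by
  simpa only [cond_neg] using A.cpmem x y z (A.neg u) v w

end CPmemAlg

/-- (MSCL4) holds in any CPmem-algebra:
`((x ∧· y) ∨· (¬x ∧· z)) ∧· u = (x ∨· (z ∧· u)) ∧· (¬x ∨· (y ∧· u))`. -/
theorem CPmemAlg.mscl4 {M : Type*} (A : CPmemAlg M) (x y z u : M) :
    A.sand (A.sor (A.sand x y) (A.sand (A.neg x) z)) u =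
      A.sand (A.sor x (A.sand z u)) (A.sor (A.neg x) (A.sand y u)) := by
  have lhs : A.sand (A.sor (A.sand x y) (A.sand (A.neg x) z)) u =
      A.cond (A.cond u y A.F) x (A.cond u z A.F) := by
    simp only [sor_eq_cond, sand, cond_neg, A.cp4, A.cp1, A.cp2,
      cond_cond_right, cond_cond_cond_left]
  have rhs : A.sand (A.sor x (A.sand z u)) (A.sor (A.neg x) (A.sand y u)) =
      A.cond (A.cond u y A.F) x (A.cond u z A.F) := by
    rw [sor_eq_cond, sor_eq_cond, cond_neg, sand, A.cp4, A.cp1, cond_cond_left,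
      cond_cond_cond_right, A.cp3]
    rfl
  rw [lhs, rhs]
end

section
/- In any EqMSCL-algebra, defining the conditional by x ◁ y ▷ z := (y ∧· x) ∨· (¬y ∧· z), the axioms of memorizing CP all hold: (CP1) x ◁ T ▷ y = x; (CP2) x ◁ F ▷ y = y; (CP3) T ◁ x ▷ F = x; (CP4) x ◁ (y ◁ z ▷ u) ▷ v = (x ◁ y ▷ v) ◁ z ▷ (x ◁ u ▷ v); and (CPmem) x ◁ y ▷ (z ◁ u ▷ (v ◁ y ▷ w)) = x ◁ y ▷ (z ◁ u ▷ w). -/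
/-- The signature of short-circuit logic: a constant `T`, negation `neg`
and left-sequential conjunction `sand` (written `x ∧· y`). -/
structure SCLSig (M : Type*) where
  T : M
  neg : M → M
  sand : M → M → M

namespace SCLSig
variable {M : Type*}
/-- `F` is defined as `¬T`. -/
def F (A : SCLSig M) : M := A.neg A.T
/-- Left-sequential disjunction: `x ∨· y = ¬(¬x ∧· ¬y)`. -/
def sor (A : SCLSig M) (x y : M) : M := A.neg (A.sand (A.neg x) (A.neg y))
end SCLSig

/-- An EqMSCL-algebra: an SCL signature (with `F = ¬T` and
`x ∨· y = ¬(¬x ∧· ¬y)`) satisfying the EqMSCL axioms. -/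
structure EqMSCL (M : Type*) extends SCLSig M where
  neg_neg : ∀ x, neg (neg x) = x
  T_sand : ∀ x, sand T x = x
  sand_T : ∀ x, sand x T = x
  F_sand : ∀ x, sand toSCLSig.F x = toSCLSig.F
  sand_assoc : ∀ x y z, sand (sand x y) z = sand x (sand y z)
  sand_F : ∀ x, sand x toSCLSig.F = sand (neg x) toSCLSig.F
  mscl1 : ∀ x y, sand x (toSCLSig.sor x y) = x
  mscl2 : ∀ x y z, sand x (toSCLSig.sor y z) =
    toSCLSig.sor (sand x y) (sand x z)
  mscl3 : ∀ x y z, sand (toSCLSig.sor x y) (toSCLSig.sor (neg x) z) =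
    sand (toSCLSig.sor (neg x) z) (toSCLSig.sor x y)
  mscl4 : ∀ x y z u,
    sand (toSCLSig.sor (sand x y) (sand (neg x) z)) u =
      sand (toSCLSig.sor x (sand z u)) (toSCLSig.sor (neg x) (sand y u))

namespace EqMSCL
variable {M : Type*}
/-- The conditional defined from the sequential connectives:
`x ◁ y ▷ z := (y ∧· x) ∨· (¬y ∧· z)`. -/
def cond (A : EqMSCL M) (x y z : M) : M :=
  A.sor (A.sand y x) (A.sand (A.neg y) z)
end EqMSCL

namespace EqMSCL
variable {M : Type*} (A : EqMSCL M)

theorem neg_F : A.neg A.F = A.T := A.neg_neg A.T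

theorem neg_sor (x y : M) : A.neg (A.sor x y) = A.sand (A.neg x) (A.neg y) := A.neg_neg _

theorem neg_sand (x y : M) : A.neg (A.sand x y) = A.sor (A.neg x) (A.neg y) := by
  simp only [SCLSig.sor, A.neg_neg]

theorem sor_F (x : M) : A.sor x A.F = x := by
  rw [SCLSig.sor, A.neg_F, A.sand_T, A.neg_neg]

theorem F_sor (x : M) : A.sor A.F x = x := by
  rw [SCLSig.sor, A.neg_F, A.T_sand, A.neg_neg]

theorem sand_self (x : M) : A.sand x x = x := by
  simpa only [A.sor_F] using A.mscl1 x A.F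

theorem sor_self (x : M) : A.sor x x = x := by
  rw [SCLSig.sor, A.sand_self, A.neg_neg]

theorem sand_F_sor (x y : M) : A.sor (A.sand x A.F) (A.sand x y) = A.sand x y := by
  rw [← A.mscl2, A.F_sor]

theorem sand_sor_F (x y : M) : A.sor (A.sand x y) (A.sand x A.F) = A.sand x y := by
  rw [← A.mscl2, A.sor_F]

theorem sand_neg_self (x : M) : A.sand x (A.neg x) = A.sand x A.F := by
  have h := A.mscl4 x A.F A.F A.F
  rw [← A.sand_F, A.sor_self, A.sand_assoc, A.F_sand, A.sor_F, A.sor_F] at h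
  exact h.symm

theorem neg_sand_self (x : M) : A.sand (A.neg x) x = A.sand (A.neg x) A.F := by
  simpa only [A.neg_neg] using A.sand_neg_self (A.neg x)

theorem sand_neg_self_sand (x y : M) : A.sand x (A.sand (A.neg x) y) = A.sand x A.F := by
  rw [← A.sand_assoc, A.sand_neg_self, A.sand_assoc, A.F_sand]

theorem sand_self_sand (x y : M) : A.sand x (A.sand x y) = A.sand x y := by
  rw [← A.sand_assoc, A.sand_self]

/-- The first operand of a conjunction is memorized when it holds. -/
theorem sand_sand_self (x y : M) : A.sand x (A.sand y x) = A.sand x y := by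
  have h : A.sand x (A.sor (A.neg x) y) = A.sand x y := by
    rw [A.mscl2, A.sand_neg_self, A.sand_F_sor]
  have hcomm := A.mscl3 x A.F y
  rw [A.sor_F] at hcomm
  rw [← A.sand_assoc, ← h, A.sand_assoc, ← hcomm, A.sand_self_sand]

theorem sand_sand_self_sand (x y z : M) :
    A.sand x (A.sand y (A.sand x z)) = A.sand x (A.sand y z) := by
  rw [← A.sand_assoc y, ← A.sand_assoc x, A.sand_sand_self, A.sand_assoc]

theorem sand_sand_neg_self_sand (x y z : M) :
    A.sand x (A.sand y (A.sand (A.neg x) z)) = A.sand x (A.sand y A.F) := by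
  rw [← A.sand_sand_self_sand, A.sand_neg_self_sand, A.sand_sand_self_sand]

theorem cond_eq_sand (x y z : M) :
    A.cond x y z = A.sand (A.sor y z) (A.sor (A.neg y) x) := by
  simpa only [cond, A.sand_T] using A.mscl4 y x z A.T

theorem neg_cond (x y z : M) : A.neg (A.cond x y z) = A.cond (A.neg x) y (A.neg z) := by
  rw [A.cond_eq_sand (A.neg x), A.mscl3, cond, A.neg_sor, A.neg_sand, A.neg_sand, A.neg_neg]

theorem cond_sand (x y z w : M) :
    A.sand (A.cond x y z) w = A.cond (A.sand x w) y (A.sand z w) := by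
  rw [A.cond_eq_sand (A.sand x w), cond, A.mscl4]

theorem cond_sor (x y z w : M) :
    A.sor (A.cond x y z) w = A.cond (A.sor x w) y (A.sor z w) := by
  simp only [SCLSig.sor, A.neg_cond, A.cond_sand]

theorem sand_cond (x y z : M) : A.sand y (A.cond x y z) = A.sand y x := by
  rw [cond, A.mscl2, A.sand_self_sand, A.sand_neg_self_sand, A.sand_sor_F]

theorem neg_sand_cond (x y z : M) : A.sand (A.neg y) (A.cond x y z) = A.sand (A.neg y) z := by
  rw [cond, A.mscl2, A.sand_self_sand, ← A.sand_assoc, A.neg_sand_self, A.sand_assoc,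
    A.F_sand, A.sand_F_sor]

theorem cond_sor_cond (a b c d z : M) :
    A.sor (A.cond a z b) (A.cond c z d) = A.cond (A.sor a c) z (A.sor b d) := by
  rw [A.cond_sor]
  conv_lhs => rw [cond]
  rw [A.mscl2, A.mscl2, A.sand_cond, A.neg_sand_cond, ← A.mscl2, ← A.mscl2, ← cond]

theorem neg_sand_sand_cond (u v w y : M) :
    A.sand (A.neg y) (A.sand u (A.cond v y w)) = A.sand (A.neg y) (A.sand u w) := by
  have h := A.sand_sand_neg_self_sand (A.neg y) u v
  rw [A.neg_neg] at h
  rw [cond, A.mscl2, A.mscl2, h, A.sand_sand_self_sand, ← A.mscl2, A.sand_F_sor]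

end EqMSCL

/-- With `x ◁ y ▷ z := (y ∧· x) ∨· (¬y ∧· z)`, the axioms of memorizing CP
all hold in any EqMSCL-algebra. -/
theorem EqMSCL.cpmem_axioms {M : Type*} (A : EqMSCL M) :
    (∀ x y, A.cond x A.T y = x) ∧
    (∀ x y, A.cond x A.F y = y) ∧
    (∀ x, A.cond A.T x A.F = x) ∧
    (∀ x y z u v, A.cond x (A.cond y z u) v =
      A.cond (A.cond x y v) z (A.cond x u v)) ∧
    (∀ x y z u v w, A.cond x y (A.cond z u (A.cond v y w)) =
      A.cond x y (A.cond z u w)) := by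
  refine ⟨fun x y => ?_, fun x y => ?_, fun x => ?_, fun x y z u v => ?_,
    fun x y z u v w => ?_⟩
  · change A.sor (A.sand A.T x) (A.sand A.F y) = x
    rw [A.T_sand, A.F_sand, A.sor_F]
  · rw [cond, A.neg_F, A.T_sand, A.F_sand, A.F_sor]
  · rw [cond, ← A.sand_F, A.sand_sor_F, A.sand_T]
  · rw [cond, A.neg_cond, A.cond_sand, A.cond_sand, A.cond_sor_cond, ← cond, ← cond]
  · have h : A.sand (A.neg y) (A.cond z u (A.cond v y w)) =
        A.sand (A.neg y) (A.cond z u w) := by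
      rw [cond, A.mscl2, A.neg_sand_sand_cond, ← A.mscl2, ← cond]
    rw [cond, h, ← cond]
end
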